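/- Let d = 2, ε = −1 (plasma case). Let f be a C¹ solution of the two-dimensional Vlasov–Poisson system, compactly supported in (x,v) locally uniformly in t, with total mass M > 0, and with ρ(t,x) = ∫_{ℝ²} f(t,x,v) dv. Then liminf_{t→+∞} ‖ρ(t,·)‖_{L²(ℝ²)} = 0. -/

import Mathlib

open MeasureTheory Set Real Filter
open scoped ENNReal Topology BigOperators

noncomputable section

theorem integral_fderiv_apply_eq_zero {V : Type*} [NormedAddCommGroup V] [NormedSpace ℝ V]
    [FiniteDimensional ℝ V] [MeasurableSpace V] [BorelSpace V] (μ : Measure V) [μ.IsAddHaarMeasure]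
    {g : V → ℝ} (hg : ContDiff ℝ 1 g) (hs : HasCompactSupport g) (w : V) :
    ∫ x, fderiv ℝ g x w ∂μ = 0 := by
  have h1 : Continuous fun x => fderiv ℝ g x w := by fun_prop (disch := norm_num)
  have h2 : Integrable (fun x => fderiv ℝ g x w) μ :=
    h1.integrable_of_hasCompactSupport (hs.fderiv_apply ℝ w)
  have h3 : Integrable g μ := hg.continuous.integrable_of_hasCompactSupport hs
  have := integral_mul_fderiv_eq_neg_fderiv_mul_of_integrable (μ := μ) (f := fun _ => (1 : ℝ)) (g := g)
    (v := w) (by simp) (by simpa using h2) (by simpa using h3) (by simp)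
    (fun x _ => (hg.differentiable (by norm_num)) x)
  simpa using this

theorem integral_fderiv_transport_eq_zero {V : Type*} [NormedAddCommGroup V] [NormedSpace ℝ V]
    [FiniteDimensional ℝ V] [MeasureSpace V] [BorelSpace V]
    [(volume : Measure V).IsAddHaarMeasure]
    {g : V × V → ℝ} (hg : ContDiff ℝ 1 g) (hs : HasCompactSupport g)
    {b : V → V} (hb : Continuous b) :
    ∫ z : V × V, fderiv ℝ g z (z.2, b z.1) = 0 := by
  have hD : Differentiable ℝ g := hg.differentiable (by norm_num)
  have hc : Continuous (fderiv ℝ g) := hg.continuous_fderiv (by norm_num)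
  have hs' := hs.fderiv (𝕜 := ℝ)
  have hcint : ∀ w : V × V → V × V, Continuous w → Integrable fun z => fderiv ℝ g z (w z) := by
    intro w hw
    refine (hc.clm_apply hw).integrable_of_hasCompactSupport (hs'.mono ?_)
    intro z hz h
    simp [h] at hz
  have e1 := hcint (fun z => (z.2, 0)) (by fun_prop)
  have e2 := hcint (fun z => (0, b z.1)) (by fun_prop)
  have hsplit : ∀ z : V × V, fderiv ℝ g z (z.2, b z.1)
      = fderiv ℝ g z (z.2, 0) + fderiv ℝ g z (0, b z.1) := by
    intro z; rw [← map_add]; simp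
  simp_rw [hsplit]
  rw [integral_add e1 e2]
  have i1 : ∫ z : V × V, fderiv ℝ g z (z.2, 0) = 0 := by
    rw [Measure.volume_eq_prod] at e1 ⊢
    rw [integral_prod_symm _ e1]
    refine integral_eq_zero_of_ae (Eventually.of_forall fun v => ?_)
    have hsl : ContDiff ℝ 1 fun x => g (x, v) := by fun_prop
    have hcs : HasCompactSupport fun x => g (x, v) := by
      refine HasCompactSupport.intro (hs.isCompact.image continuous_fst) fun x hx => ?_
      by_contra h
      exact hx ⟨(x, v), subset_tsupport _ h, rfl⟩
    have := integral_fderiv_apply_eq_zero volume hsl hcs v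
    rw [Pi.zero_apply, ← this]
    refine integral_congr_ae (Eventually.of_forall fun x => ?_)
    have := (HasFDerivAt.comp (f := fun x => (x, v)) x (hD (x, v)).hasFDerivAt
      ((hasFDerivAt_id x).prodMk (hasFDerivAt_const v x))).fderiv
    simp only [Function.comp_def] at this
    simp [this]
  have i2 : ∫ z : V × V, fderiv ℝ g z (0, b z.1) = 0 := by
    rw [Measure.volume_eq_prod] at e2 ⊢
    rw [integral_prod _ e2]
    refine integral_eq_zero_of_ae (Eventually.of_forall fun x => ?_)
    have hsl : ContDiff ℝ 1 fun v => g (x, v) := by fun_prop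
    have hcs : HasCompactSupport fun v => g (x, v) := by
      refine HasCompactSupport.intro (hs.isCompact.image continuous_snd) fun v hx => ?_
      by_contra h
      exact hx ⟨(x, v), subset_tsupport _ h, rfl⟩
    have := integral_fderiv_apply_eq_zero volume hsl hcs (b x)
    rw [Pi.zero_apply, ← this]
    refine integral_congr_ae (Eventually.of_forall fun v => ?_)
    have := (HasFDerivAt.comp (f := fun v => (x, v)) v (hD (x, v)).hasFDerivAt
      ((hasFDerivAt_const x v).prodMk (hasFDerivAt_id v))).fderiv
    simp only [Function.comp_def] at this
    simp [this]
  rw [i1, i2, add_zero]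

theorem hasDerivAt_integral_of_contDiff {W : Type*} [NormedAddCommGroup W] [NormedSpace ℝ W]
    [FiniteDimensional ℝ W] [MeasurableSpace W] [BorelSpace W] (μ : Measure W)
    [IsFiniteMeasureOnCompacts μ] {g : ℝ × W → ℝ} (hg : ContDiff ℝ 1 g) {k : Set W}
    (hk : IsCompact k) {s : Set ℝ} (hs : IsOpen s) (hsupp : ∀ t ∈ s, ∀ z ∉ k, g (t, z) = 0)
    {t : ℝ} (ht : t ∈ s) :
    HasDerivAt (fun t => ∫ z, g (t, z) ∂μ) (∫ z, fderiv ℝ g (t, z) (1, 0) ∂μ) t := by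
  have hc : Continuous fun p => fderiv ℝ g p (1, 0) := by
    have := hg.continuous_fderiv (by norm_num)
    fun_prop
  have hder : ∀ (z : W) (r : ℝ), HasDerivAt (fun r => g (r, z)) (fderiv ℝ g (r, z) (1, 0)) r := by
    intro z r
    exact (hg.differentiable (by norm_num) (r, z)).hasFDerivAt.comp_hasDerivAt r
      ((hasDerivAt_id r).prodMk (hasDerivAt_const r z))
  obtain ⟨ε, hε, hεs⟩ := Metric.isOpen_iff.1 hs t ht
  have hzero : ∀ r ∈ s, ∀ z ∉ k, fderiv ℝ g (r, z) (1, 0) = 0 := by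
    intro r hr z hz
    rw [← (hder z r).deriv]
    have : (fun r => g (r, z)) =ᶠ[𝓝 r] fun _ => 0 := by
      filter_upwards [hs.mem_nhds hr] with r' hr' using hsupp r' hr' z hz
    rw [this.deriv_eq]; simp
  obtain ⟨C, hC⟩ := ((isCompact_closedBall t (ε / 2)).prod hk).exists_bound_of_continuousOn
    hc.continuousOn
  refine (hasDerivAt_integral_of_dominated_loc_of_deriv_le (μ := μ) (s := Metric.ball t (ε / 2))
    (F := fun r z => g (r, z)) (F' := fun r z => fderiv ℝ g (r, z) (1, 0))
    (bound := k.indicator fun _ => C)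
    (Metric.ball_mem_nhds t (by positivity)) ?_ ?_ ?_ ?_ ?_ ?_).2
  · refine Eventually.of_forall fun r => ?_
    have : Continuous fun z => g (r, z) := by have := hg.continuous; fun_prop
    exact this.aestronglyMeasurable
  · have : Continuous fun z => g (t, z) := by have := hg.continuous; fun_prop
    exact this.integrable_of_hasCompactSupport (HasCompactSupport.intro hk (hsupp t ht))
  · have : Continuous fun z => fderiv ℝ g (t, z) (1, 0) := by fun_prop
    exact this.aestronglyMeasurable
  · refine Eventually.of_forall fun z r hr => ?_
    by_cases hz : z ∈ k
    · rw [indicator_of_mem hz]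
      exact hC (r, z) ⟨Metric.ball_subset_closedBall hr, hz⟩
    · rw [indicator_of_notMem hz, hzero r (hεs (Metric.ball_subset_ball (by linarith) hr)) z hz]
      simp
  · exact (integrable_indicator_iff hk.measurableSet).2
      (integrableOn_const (hk.measure_lt_top.ne))
  · exact Eventually.of_forall fun z r _ => hder z r

theorem contDiffOn_integral_of_contDiff {P W : Type*} [NormedAddCommGroup P] [NormedSpace ℝ P]
    [NormedAddCommGroup W] [NormedSpace ℝ W]
    [FiniteDimensional ℝ W] [MeasurableSpace W] [BorelSpace W] (μ : Measure W)
    [μ.IsAddHaarMeasure] {g : P × W → ℝ} (hg : ContDiff ℝ 1 g) {k : Set W}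
    (hk : IsCompact k) {s : Set P} (hs : IsOpen s) (hsupp : ∀ t ∈ s, ∀ z ∉ k, g (t, z) = 0) :
    ContDiffOn ℝ 1 (fun t => ∫ z, g (t, z) ∂μ) s := by
  have h := contDiffOn_convolution_right_with_param (𝕜 := ℝ) (n := 1) (μ := μ)
    (L := ContinuousLinearMap.mul ℝ ℝ) (f := fun _ : W => (1 : ℝ)) (g := fun p z => g (p, z))
    hs hk (fun p x hp hx => hsupp p hp x hx) (locallyIntegrable_const _)
    (by exact hg.contDiffOn)
  have h2 : ContDiffOn ℝ 1 (fun p : P => (p, (0 : W))) s := by fun_prop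
  refine (h.comp h2 (fun p hp => ⟨hp, mem_univ _⟩)).congr fun p hp => ?_
  simp only [Function.comp_def, convolution_def, ContinuousLinearMap.mul_apply', one_mul, zero_sub]
  exact (integral_neg_eq_self (fun z => g (p, z)) μ).symm

theorem integrableOn_log_norm_ball (R : ℝ) :
    IntegrableOn (fun x : EuclideanSpace ℝ (Fin 2) => Real.log ‖x‖) (Metric.ball 0 R) := by
  rw [integrableOn_fun_norm_addHaar volume (f := Real.log)]
  have hc : Continuous fun y : ℝ => y * Real.log y := Real.continuous_mul_log
  have h := (hc.integrableOn_Icc (μ := volume) (a := 0) (b := R)).mono_set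
    (Ioo_subset_Icc_self)
  refine h.congr_fun (fun y _ => ?_) measurableSet_Ioo
  simp

theorem locallyIntegrable_log_norm :
    LocallyIntegrable (fun x : EuclideanSpace ℝ (Fin 2) => Real.log ‖x‖) volume := by
  intro x
  refine ⟨Metric.ball 0 (‖x‖ + 1), Metric.isOpen_ball.mem_nhds (by simp), ?_⟩
  exact integrableOn_log_norm_ball _

theorem integrableOn_log_norm_sub_prod {k : Set (EuclideanSpace ℝ (Fin 2))} (hk : IsCompact k) :
    IntegrableOn (fun p : EuclideanSpace ℝ (Fin 2) × EuclideanSpace ℝ (Fin 2) =>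
      Real.log ‖p.1 - p.2‖) (k ×ˢ k) volume := by
  obtain ⟨R, hR⟩ := hk.isBounded.subset_ball 0
  have h1 : Integrable (k.indicator fun _ : EuclideanSpace ℝ (Fin 2) => (1 : ℝ)) volume :=
    (integrable_indicator_iff hk.measurableSet).2 (integrableOn_const hk.measure_lt_top.ne)
  have h2 : Integrable ((Metric.ball (0 : EuclideanSpace ℝ (Fin 2)) (R + R)).indicator
      fun x => Real.log ‖x‖) volume :=
    (integrable_indicator_iff measurableSet_ball).2 (integrableOn_log_norm_ball _)
  have h3 := h1.convolution_integrand (ContinuousLinearMap.mul ℝ ℝ) h2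
  refine h3.integrableOn.congr_fun (fun p hp => ?_) (hk.measurableSet.prod hk.measurableSet)
  have hb : p.1 - p.2 ∈ Metric.ball (0 : EuclideanSpace ℝ (Fin 2)) (R + R) := by
    have a := hR hp.1
    have b := hR hp.2
    rw [mem_ball_zero_iff] at *
    exact (norm_sub_le _ _).trans_lt (by linarith)
  simp [indicator_of_mem hp.2, indicator_of_mem hb]

theorem integrable_log_norm_sub_mul {k : Set (EuclideanSpace ℝ (Fin 2))} (hk : IsCompact k)
    {a b : EuclideanSpace ℝ (Fin 2) → ℝ} (ha : Continuous a) (hb : Continuous b)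
    (ha0 : ∀ x ∉ k, a x = 0) (hb0 : ∀ x ∉ k, b x = 0) :
    Integrable (fun p : EuclideanSpace ℝ (Fin 2) × EuclideanSpace ℝ (Fin 2) =>
      Real.log ‖p.1 - p.2‖ * (a p.1 * b p.2)) volume := by
  have h := (integrableOn_log_norm_sub_prod hk).mul_continuousOn
    (g' := fun p : EuclideanSpace ℝ (Fin 2) × EuclideanSpace ℝ (Fin 2) => a p.1 * b p.2)
    (by fun_prop) (hk.prod hk)
  refine (integrableOn_iff_integrable_of_support_subset ?_).1 h
  intro p hp
  by_contra hpk
  apply hp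
  rw [mem_prod, not_and_or] at hpk
  rcases hpk with h | h
  · simp [ha0 _ h]
  · simp [hb0 _ h]

/-- The logarithmic potential of a planar density. -/
def logPotential (σ : EuclideanSpace ℝ (Fin 2) → ℝ) (x : EuclideanSpace ℝ (Fin 2)) : ℝ :=
  ∫ y, Real.log ‖x - y‖ * σ y

/-- The logarithmic interaction of a planar density with itself. -/
def logEnergy (σ : EuclideanSpace ℝ (Fin 2) → ℝ) : ℝ :=
  ∫ p : EuclideanSpace ℝ (Fin 2) × EuclideanSpace ℝ (Fin 2),
    Real.log ‖p.1 - p.2‖ * (σ p.1 * σ p.2)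

theorem contDiff_logPotential {σ : EuclideanSpace ℝ (Fin 2) → ℝ} (hσ : ContDiff ℝ 1 σ)
    (hs : HasCompactSupport σ) : ContDiff ℝ 1 (logPotential σ) := by
  have h := hs.contDiff_convolution_left (ContinuousLinearMap.mul ℝ ℝ) (n := 1) (μ := volume)
    (by exact hσ) locallyIntegrable_log_norm
  refine (show logPotential σ = _ from ?_) ▸ h
  ext x
  simp only [logPotential, convolution_def, ContinuousLinearMap.mul_apply']
  exact integral_congr_ae (Eventually.of_forall fun y => mul_comm _ _)

theorem integral_log_norm_sub_mul {k : Set (EuclideanSpace ℝ (Fin 2))} (hk : IsCompact k)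
    {a b : EuclideanSpace ℝ (Fin 2) → ℝ} (ha : Continuous a) (hb : Continuous b)
    (ha0 : ∀ x ∉ k, a x = 0) (hb0 : ∀ x ∉ k, b x = 0) :
    ∫ p : EuclideanSpace ℝ (Fin 2) × EuclideanSpace ℝ (Fin 2),
      Real.log ‖p.1 - p.2‖ * (a p.1 * b p.2) = ∫ x, logPotential b x * a x := by
  have h := integrable_log_norm_sub_mul hk ha hb ha0 hb0
  rw [Measure.volume_eq_prod] at h ⊢
  rw [integral_prod _ h]
  refine integral_congr_ae (Eventually.of_forall fun x => ?_)
  simp only [logPotential]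
  rw [← integral_mul_const]
  exact integral_congr_ae (Eventually.of_forall fun y => by ring)

theorem logEnergy_eq {σ : EuclideanSpace ℝ (Fin 2) → ℝ} (hσ : Continuous σ)
    (hs : HasCompactSupport σ) : logEnergy σ = ∫ x, logPotential σ x * σ x :=
  integral_log_norm_sub_mul hs.isCompact hσ hσ (fun _ => image_eq_zero_of_notMem_tsupport)
    (fun _ => image_eq_zero_of_notMem_tsupport)

theorem hasDerivAt_logEnergy {σ : ℝ × EuclideanSpace ℝ (Fin 2) → ℝ} {s : Set ℝ} (hs : IsOpen s)
    (hσ : ContDiffOn ℝ 1 σ (s ×ˢ univ)) {k : Set (EuclideanSpace ℝ (Fin 2))} (hk : IsCompact k)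
    (hsupp : ∀ t ∈ s, ∀ x ∉ k, σ (t, x) = 0) {t : ℝ} (ht : t ∈ s) :
    HasDerivAt (fun t => logEnergy fun x => σ (t, x))
      (2 * ∫ x, logPotential (fun x => σ (t, x)) x * fderiv ℝ σ (t, x) (1, 0)) t := by
  have hso : IsOpen (s ×ˢ (univ : Set (EuclideanSpace ℝ (Fin 2)))) := hs.prod isOpen_univ
  have hc : ContinuousOn (fun p => fderiv ℝ σ p (1, 0)) (s ×ˢ univ) := by
    have := hσ.continuousOn_fderiv_of_isOpen hso le_rfl
    fun_prop
  have hc1 : ∀ r ∈ s, Continuous fun x => fderiv ℝ σ (r, x) (1, 0) := by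
    intro r hr
    exact hc.comp_continuous (by fun_prop : Continuous fun x => (r, x)) (fun x => ⟨hr, mem_univ _⟩)
  have hc0 : ∀ r ∈ s, Continuous fun x => σ (r, x) := by
    intro r hr
    exact hσ.continuousOn.comp_continuous (by fun_prop : Continuous fun x => (r, x))
      (fun x => ⟨hr, mem_univ _⟩)
  have hder : ∀ (x : EuclideanSpace ℝ (Fin 2)) (r : ℝ), r ∈ s →
      HasDerivAt (fun r => σ (r, x)) (fderiv ℝ σ (r, x) (1, 0)) r := by
    intro x r hr
    have hd : DifferentiableAt ℝ σ (r, x) :=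
      (hσ.differentiableOn (by norm_num)).differentiableAt (hso.mem_nhds ⟨hr, mem_univ _⟩)
    exact hd.hasFDerivAt.comp_hasDerivAt r ((hasDerivAt_id r).prodMk (hasDerivAt_const r x))
  obtain ⟨ε, hε, hεs⟩ := Metric.isOpen_iff.1 hs t ht
  have hzero : ∀ r ∈ s, ∀ x ∉ k, fderiv ℝ σ (r, x) (1, 0) = 0 := by
    intro r hr x hx
    rw [← (hder x r hr).deriv]
    have : (fun r => σ (r, x)) =ᶠ[𝓝 r] fun _ => 0 := by
      filter_upwards [hs.mem_nhds hr] with r' hr' using hsupp r' hr' x hx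
    rw [this.deriv_eq]; simp
  have hsub : Metric.closedBall t (ε / 2) ⊆ s :=
    (Metric.closedBall_subset_ball (by linarith)).trans hεs
  obtain ⟨C, hC⟩ := ((isCompact_closedBall t (ε / 2)).prod hk).exists_bound_of_continuousOn
    (hc.mono (prod_mono hsub (subset_univ _)))
  obtain ⟨D, hD⟩ := ((isCompact_closedBall t (ε / 2)).prod hk).exists_bound_of_continuousOn
    (hσ.continuousOn.mono (prod_mono hsub (subset_univ _)))
  have hkey := (hasDerivAt_integral_of_dominated_loc_of_deriv_le (s := Metric.ball t (ε / 2))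
    (μ := (volume : Measure (EuclideanSpace ℝ (Fin 2) × EuclideanSpace ℝ (Fin 2))))
    (F := fun r p => Real.log ‖p.1 - p.2‖ * (σ (r, p.1) * σ (r, p.2)))
    (F' := fun r p => Real.log ‖p.1 - p.2‖ *
      (fderiv ℝ σ (r, p.1) (1, 0) * σ (r, p.2) + σ (r, p.1) * fderiv ℝ σ (r, p.2) (1, 0)))
    (bound := (k ×ˢ k).indicator fun p => |Real.log ‖p.1 - p.2‖| * (C * D + D * C)) (x₀ := t)
    (Metric.ball_mem_nhds t (by positivity)) ?_ ?_ ?_ ?_ ?_ ?_).2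
  · have i1 := integrable_log_norm_sub_mul hk (hc1 t ht) (hc0 t ht) (hzero t ht) (hsupp t ht)
    have i2 := integrable_log_norm_sub_mul hk (hc0 t ht) (hc1 t ht) (hsupp t ht) (hzero t ht)
    simp only [mul_add] at hkey
    rw [integral_add i1 i2] at hkey
    have hsw : ∫ p : EuclideanSpace ℝ (Fin 2) × EuclideanSpace ℝ (Fin 2),
        Real.log ‖p.1 - p.2‖ * (σ (t, p.1) * fderiv ℝ σ (t, p.2) (1, 0))
        = ∫ p : EuclideanSpace ℝ (Fin 2) × EuclideanSpace ℝ (Fin 2),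
        Real.log ‖p.1 - p.2‖ * (fderiv ℝ σ (t, p.1) (1, 0) * σ (t, p.2)) := by
      rw [Measure.volume_eq_prod, ← integral_prod_swap]
      refine integral_congr_ae (Eventually.of_forall fun p => ?_)
      simp only [Prod.fst_swap, Prod.snd_swap, norm_sub_rev p.2 p.1]
      ring
    rw [hsw, ← two_mul,
      integral_log_norm_sub_mul hk (hc1 t ht) (hc0 t ht) (hzero t ht) (hsupp t ht)] at hkey
    exact hkey
  · filter_upwards [hs.mem_nhds ht] with r hr
    exact (integrable_log_norm_sub_mul hk (hc0 r hr) (hc0 r hr) (hsupp r hr)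
      (hsupp r hr)).aestronglyMeasurable
  · exact integrable_log_norm_sub_mul hk (hc0 t ht) (hc0 t ht) (hsupp t ht) (hsupp t ht)
  · simp only [mul_add]
    exact ((integrable_log_norm_sub_mul hk (hc1 t ht) (hc0 t ht) (hzero t ht) (hsupp t ht)).add
      (integrable_log_norm_sub_mul hk (hc0 t ht) (hc1 t ht) (hsupp t ht)
        (hzero t ht))).aestronglyMeasurable
  · refine Eventually.of_forall fun p r hr => ?_
    have hrs : r ∈ s := hsub (Metric.ball_subset_closedBall hr)
    by_cases hp : p ∈ k ×ˢ k
    · rw [indicator_of_mem hp, norm_mul, Real.norm_eq_abs]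
      have hr' := Metric.ball_subset_closedBall hr
      have a1 := hC (r, p.1) ⟨hr', hp.1⟩
      have a2 := hC (r, p.2) ⟨hr', hp.2⟩
      have a3 := hD (r, p.1) ⟨hr', hp.1⟩
      have a4 := hD (r, p.2) ⟨hr', hp.2⟩
      refine mul_le_mul_of_nonneg_left ((norm_add_le _ _).trans (add_le_add ?_ ?_)) (abs_nonneg _)
      · rw [norm_mul]
        exact mul_le_mul a1 a4 (norm_nonneg _) ((norm_nonneg _).trans a1)
      · rw [norm_mul]
        exact mul_le_mul a3 a2 (norm_nonneg _) ((norm_nonneg _).trans a3)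
    · rw [indicator_of_notMem hp]
      rw [mem_prod, not_and_or] at hp
      rcases hp with h | h
      · simp [hsupp r hrs _ h, hzero r hrs _ h]
      · simp [hsupp r hrs _ h, hzero r hrs _ h]
  · exact (integrable_indicator_iff (hk.measurableSet.prod hk.measurableSet)).2
      ((integrableOn_log_norm_sub_prod hk).abs.mul_const _)
  · refine Eventually.of_forall fun p r hr => ?_
    have hrs : r ∈ s := hsub (Metric.ball_subset_closedBall hr)
    exact ((hder p.1 r hrs).mul (hder p.2 r hrs)).const_mul _

theorem integral_fderiv_self {g : EuclideanSpace ℝ (Fin 2) → ℝ} (hg : ContDiff ℝ 1 g)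
    (hs : HasCompactSupport g) : ∫ x, fderiv ℝ g x x = -2 * ∫ x, g x := by
  have hD : Differentiable ℝ g := hg.differentiable (by norm_num)
  have hc : Continuous (fderiv ℝ g) := hg.continuous_fderiv (by norm_num)
  have hgi : Integrable g := hg.continuous.integrable_of_hasCompactSupport hs
  have hgi' : Integrable fun x => fderiv ℝ g x x := by
    refine (hc.clm_apply continuous_id).integrable_of_hasCompactSupport
      ((hs.fderiv (𝕜 := ℝ)).mono ?_)
    intro z hz h
    simp [h] at hz
  let e : Fin 2 → EuclideanSpace ℝ (Fin 2) := fun i => EuclideanSpace.single i (1 : ℝ)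
  have key : ∀ i : Fin 2, ∫ x, (g x + fderiv ℝ g x (x i • e i)) = 0 := by
    intro i
    have hp : ContDiff ℝ 1 fun x : EuclideanSpace ℝ (Fin 2) => x i * g x := by fun_prop
    rw [← integral_fderiv_apply_eq_zero volume hp hs.mul_left (e i)]
    refine integral_congr_ae (Eventually.of_forall fun x => ?_)
    have hpr : HasFDerivAt (fun x : EuclideanSpace ℝ (Fin 2) => x i)
        (EuclideanSpace.proj (𝕜 := ℝ) i : EuclideanSpace ℝ (Fin 2) →L[ℝ] ℝ) x :=
      (EuclideanSpace.proj (𝕜 := ℝ) i : EuclideanSpace ℝ (Fin 2) →L[ℝ] ℝ).hasFDerivAt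
    have h := (hpr.mul (hD x).hasFDerivAt).fderiv
    have h' : fderiv ℝ (fun x : EuclideanSpace ℝ (Fin 2) => x i * g x) x = _ := h
    simp only [h']
    simp [e]
    ring
  have hi : ∀ i : Fin 2, Integrable fun x => fderiv ℝ g x (x i • e i) := by
    intro i
    have h1 : Continuous fun x : EuclideanSpace ℝ (Fin 2) => x i • e i := by fun_prop
    refine (hc.clm_apply h1).integrable_of_hasCompactSupport ((hs.fderiv (𝕜 := ℝ)).mono ?_)
    intro z hz h
    simp [h] at hz
  have hdec : ∀ x : EuclideanSpace ℝ (Fin 2),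
      fderiv ℝ g x x = fderiv ℝ g x (x 0 • e 0) + fderiv ℝ g x (x 1 • e 1) := by
    intro x
    rw [← map_add]
    congr 1
    ext j
    fin_cases j <;> simp [e]
  have k0 := key 0
  have k1 := key 1
  rw [integral_add hgi (hi _)] at k0 k1
  simp_rw [hdec]
  rw [integral_add (hi 0) (hi 1)]
  linarith

instance isAddHaarMeasure_volume_plane_prod :
    (volume : Measure (EuclideanSpace ℝ (Fin 2) × EuclideanSpace ℝ (Fin 2))).IsAddHaarMeasure := by
  rw [Measure.volume_eq_prod]
  infer_instance

theorem ae_fst_ne_snd : ∀ᵐ p : EuclideanSpace ℝ (Fin 2) × EuclideanSpace ℝ (Fin 2),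
    p.1 - p.2 ≠ 0 := by
  let L : (EuclideanSpace ℝ (Fin 2) × EuclideanSpace ℝ (Fin 2)) →ₗ[ℝ] EuclideanSpace ℝ (Fin 2) :=
    LinearMap.fst ℝ _ _ - LinearMap.snd ℝ _ _
  have hL : LinearMap.ker L ≠ ⊤ := by
    intro h
    have h2 : (EuclideanSpace.single (0 : Fin 2) (1 : ℝ), (0 : EuclideanSpace ℝ (Fin 2)))
        ∈ LinearMap.ker L := by rw [h]; trivial
    simp [L] at h2
  have h := Measure.addHaar_submodule
    (volume : Measure (EuclideanSpace ℝ (Fin 2) × EuclideanSpace ℝ (Fin 2))) _ hL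
  refine measure_mono_null (fun p hp => ?_) h
  simpa [L] using hp

theorem logEnergy_dilation {σ : EuclideanSpace ℝ (Fin 2) → ℝ} (hσ : Continuous σ)
    (hs : HasCompactSupport σ) (s : ℝ) :
    logEnergy (fun x => σ (Real.exp (-s) • x))
      = Real.exp (4 * s) * (logEnergy σ + s * (∫ x, σ x) ^ 2) := by
  have hσ0 : ∀ x ∉ tsupport σ, σ x = 0 := fun _ => image_eq_zero_of_notMem_tsupport
  have h1 := integrable_log_norm_sub_mul hs.isCompact hσ hσ hσ0 hσ0
  have hσi : Integrable σ := hσ.integrable_of_hasCompactSupport hs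
  have h2 : Integrable (fun p : EuclideanSpace ℝ (Fin 2) × EuclideanSpace ℝ (Fin 2) =>
      σ p.1 * σ p.2) volume := hσi.mul_prod hσi
  have h3 : ∫ p : EuclideanSpace ℝ (Fin 2) × EuclideanSpace ℝ (Fin 2), σ p.1 * σ p.2
      = (∫ x, σ x) ^ 2 := by
    rw [Measure.volume_eq_prod, integral_prod_mul, sq]
  have hcv := Measure.integral_comp_smul
    (volume : Measure (EuclideanSpace ℝ (Fin 2) × EuclideanSpace ℝ (Fin 2)))
    (fun p => Real.log ‖Real.exp s • (p.1 - p.2)‖ * (σ p.1 * σ p.2)) (Real.exp (-s))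
  have hfin : Module.finrank ℝ (EuclideanSpace ℝ (Fin 2) × EuclideanSpace ℝ (Fin 2)) = 4 := by
    simp
  have hfac : |(Real.exp (-s) ^ 4)⁻¹| = Real.exp (4 * s) := by
    rw [abs_of_pos (by positivity), ← Real.exp_nat_mul, ← Real.exp_neg]
    congr 1; push_cast; ring
  rw [hfin, hfac, smul_eq_mul] at hcv
  have hL : logEnergy (fun x => σ (Real.exp (-s) • x)) = ∫ p : EuclideanSpace ℝ (Fin 2) ×
      EuclideanSpace ℝ (Fin 2), Real.log ‖Real.exp s • ((Real.exp (-s) • p).1 -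
        (Real.exp (-s) • p).2)‖ * (σ (Real.exp (-s) • p).1 * σ (Real.exp (-s) • p).2) := by
    refine integral_congr_ae (Eventually.of_forall fun p => ?_)
    simp only [Prod.smul_fst, Prod.smul_snd]
    rw [← smul_sub, smul_smul, ← Real.exp_add]
    simp
  rw [hL, hcv]
  congr 1
  rw [logEnergy, ← h3, ← integral_const_mul, ← integral_add h1 (h2.const_mul s)]
  refine integral_congr_ae ?_
  filter_upwards [ae_fst_ne_snd] with p hp
  rw [norm_smul, Real.log_mul (by simp) (by simpa using hp)]
  simp
  ring

theorem integral_fderiv_logPotential_self_mul {σ : EuclideanSpace ℝ (Fin 2) → ℝ}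
    (hσ : ContDiff ℝ 1 σ) (hs : HasCompactSupport σ) :
    ∫ x, fderiv ℝ (logPotential σ) x x * σ x = (∫ x, σ x) ^ 2 / 2 := by
  have hΦ := contDiff_logPotential hσ hs
  have hσ0 : ∀ x ∉ tsupport σ, σ x = 0 := fun _ => image_eq_zero_of_notMem_tsupport
  have hσD : Differentiable ℝ σ := hσ.differentiable (by norm_num)
  have hΦD : Differentiable ℝ (logPotential σ) := hΦ.differentiable (by norm_num)
  have hσc := hσ.continuous_fderiv (by norm_num)
  have hΦc := hΦ.continuous_fderiv (by norm_num)
  obtain ⟨R, hR0, hR⟩ := hs.isCompact.isBounded.subset_ball_lt 0 0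
  have hd := hasDerivAt_logEnergy (σ := fun q : ℝ × EuclideanSpace ℝ (Fin 2) =>
    σ (Real.exp (-q.1) • q.2)) (s := Ioo (-1) 1) (k := Metric.closedBall 0 (Real.exp 1 * R)) (t := 0)
    isOpen_Ioo (by fun_prop) (isCompact_closedBall _ _) ?_ (by simp)
  · have hd2 : HasDerivAt (fun s => logEnergy fun x => σ (Real.exp (-s) • x))
        (4 * logEnergy σ + (∫ x, σ x) ^ 2) 0 := by
      simp_rw [logEnergy_dilation hσ.continuous hs]
      have a1 : HasDerivAt (fun s : ℝ => Real.exp (4 * s)) (Real.exp (4 * 0) * (4 * 1)) 0 :=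
        ((hasDerivAt_id (0 : ℝ)).const_mul 4).exp
      have a2 : HasDerivAt (fun s : ℝ => logEnergy σ + s * (∫ x, σ x) ^ 2)
          (1 * (∫ x, σ x) ^ 2) 0 := ((hasDerivAt_id (0 : ℝ)).mul_const _).const_add _
      refine (a1.mul a2).congr_deriv ?_
      simp
    have hu := hd.unique hd2
    have hder : ∀ x, fderiv ℝ (fun q : ℝ × EuclideanSpace ℝ (Fin 2) =>
        σ (Real.exp (-q.1) • q.2)) (0, x) (1, 0) = -fderiv ℝ σ x x := by
      intro x
      have b1 : HasFDerivAt (fun q : ℝ × EuclideanSpace ℝ (Fin 2) => σ (Real.exp (-q.1) • q.2))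
          (fderiv ℝ (fun q : ℝ × EuclideanSpace ℝ (Fin 2) =>
            σ (Real.exp (-q.1) • q.2)) (0, x)) (0, x) := by
        have : Differentiable ℝ (fun q : ℝ × EuclideanSpace ℝ (Fin 2) =>
          σ (Real.exp (-q.1) • q.2)) := by fun_prop
        exact (this _).hasFDerivAt
      have b2 := b1.comp_hasDerivAt (0 : ℝ) ((hasDerivAt_id (0 : ℝ)).prodMk (hasDerivAt_const 0 x))
      have b3 : HasDerivAt (fun s : ℝ => Real.exp (-s) • x)
          ((Real.exp (-0) * (-1)) • x) 0 := ((hasDerivAt_id (0 : ℝ)).neg.exp).smul_const x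
      have b4 := (hσD (Real.exp (-0) • x)).hasFDerivAt.comp_hasDerivAt (0 : ℝ) b3
      have := b2.unique b4
      rw [this]
      simp
    simp_rw [hder] at hu
    simp only [neg_zero, Real.exp_zero, one_smul] at hu
    have hcs1 : HasCompactSupport fun x => logPotential σ x * fderiv ℝ σ x x := by
      refine (hs.fderiv (𝕜 := ℝ)).mono fun x hx h => ?_
      simp [h] at hx
    have i1 : Integrable fun x => logPotential σ x * fderiv ℝ σ x x :=
      (hΦ.continuous.mul (hσc.clm_apply continuous_id)).integrable_of_hasCompactSupport hcs1
    have i2 : Integrable fun x => fderiv ℝ (logPotential σ) x x * σ x :=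
      ((hΦc.clm_apply continuous_id).mul hσ.continuous).integrable_of_hasCompactSupport hs.mul_left
    have hself := integral_fderiv_self (hΦ.mul hσ) hs.mul_left
    have hprod : ∀ x, fderiv ℝ (fun x => logPotential σ x * σ x) x x
        = logPotential σ x * fderiv ℝ σ x x + fderiv ℝ (logPotential σ) x x * σ x := by
      intro x
      have := ((hΦD x).hasFDerivAt.mul (hσD x).hasFDerivAt).fderiv
      have h' : fderiv ℝ (fun x => logPotential σ x * σ x) x = _ := this
      simp only [h']
      simp
      ring
    simp_rw [hprod] at hself
    rw [integral_add i1 i2, ← logEnergy_eq hσ.continuous hs] at hself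
    simp only [mul_neg, integral_neg] at hu
    linarith
  · intro t ht x hx
    apply hσ0
    intro h
    have h2 := hR h
    rw [mem_ball_zero_iff, norm_smul, Real.norm_of_nonneg (Real.exp_pos _).le] at h2
    apply hx
    rw [mem_closedBall_zero_iff]
    have h3 : ‖x‖ = Real.exp t * (Real.exp (-t) * ‖x‖) := by
      rw [← mul_assoc, ← Real.exp_add]; simp
    rw [h3]
    exact mul_le_mul (Real.exp_le_exp.2 ht.2.le) h2.le (by positivity) (by positivity)

theorem hasDerivAt_max_zero_sq (s : ℝ) :
    HasDerivAt (fun s : ℝ => (max s 0) ^ 2) (2 * max s 0) s := by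
  rcases lt_trichotomy s 0 with h | h | h
  · have : (fun s : ℝ => (max s 0) ^ 2) =ᶠ[𝓝 s] fun _ => 0 := by
      filter_upwards [Iio_mem_nhds h] with r hr
      simp [max_eq_right (mem_Iio.1 hr).le]
    rw [max_eq_right h.le]
    simpa using (hasDerivAt_const s (0 : ℝ)).congr_of_eventuallyEq this
  · subst h
    rw [max_self, mul_zero, hasDerivAt_iff_isLittleO]
    have h1 : (fun r : ℝ => (max r 0) ^ 2 - (max 0 0) ^ 2 - (r - 0) • (0 : ℝ))
        =O[𝓝 0] fun r => r ^ 2 := by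
      refine Asymptotics.IsBigO.of_bound 1 (Eventually.of_forall fun r => ?_)
      simp only [max_self, smul_zero, sub_zero, Real.norm_eq_abs, one_mul, ne_eq,
        OfNat.ofNat_ne_zero, not_false_eq_true, zero_pow]
      rw [abs_of_nonneg (by positivity), abs_of_nonneg (by positivity)]
      rcases le_total r 0 with h | h
      · rw [max_eq_right h]; nlinarith [sq_nonneg r]
      · rw [max_eq_left h]
    refine h1.trans_isLittleO ?_
    simpa using Asymptotics.isLittleO_pow_id (𝕜 := ℝ) (n := 2) (by norm_num)
  · have : (fun s : ℝ => (max s 0) ^ 2) =ᶠ[𝓝 s] fun r => r ^ 2 := by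
      filter_upwards [Ioi_mem_nhds h] with r hr
      simp [max_eq_left (mem_Ioi.1 hr).le]
    rw [max_eq_left h.le]
    refine ((hasDerivAt_pow 2 s).congr_of_eventuallyEq this).congr_deriv ?_
    simp

/-- The spatial density of a phase space distribution on `ℝ × (ℝ² × ℝ²)`. -/
def density (F : ℝ × EuclideanSpace ℝ (Fin 2) × EuclideanSpace ℝ (Fin 2) → ℝ) (t : ℝ)
    (x : EuclideanSpace ℝ (Fin 2)) : ℝ :=
  ∫ v, F (t, x, v)

/-- The repulsive force field `-∇U` generated by a phase space distribution. -/
def force (F : ℝ × EuclideanSpace ℝ (Fin 2) × EuclideanSpace ℝ (Fin 2) → ℝ) (t : ℝ)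
    (x : EuclideanSpace ℝ (Fin 2)) : EuclideanSpace ℝ (Fin 2) :=
  (1 / (2 * π)) • gradient (logPotential (density F t)) x

/-- Classical solutions of the two-dimensional Vlasov–Poisson system in the plasma case with
total mass `M`, on positive times. -/
structure IsPlasmaSolution
    (F : ℝ × EuclideanSpace ℝ (Fin 2) × EuclideanSpace ℝ (Fin 2) → ℝ) (M : ℝ) : Prop where
  contDiff : ContDiff ℝ 1 F
  nonneg : ∀ p, 0 ≤ F p
  supp : ∀ T : ℝ, ∃ K : ℝ, ∀ t ∈ Ioo 0 T, ∀ x v,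
    (x ∉ Metric.closedBall 0 K ∨ v ∉ Metric.closedBall 0 K) → F (t, x, v) = 0
  mass : ∀ t, 0 < t → ∫ z, F (t, z) = M
  vlasov : ∀ t, 0 < t → ∀ x v, fderiv ℝ F (t, x, v) (1, v, force F t x) = 0

namespace IsPlasmaSolution

variable {F : ℝ × EuclideanSpace ℝ (Fin 2) × EuclideanSpace ℝ (Fin 2) → ℝ} {M : ℝ}

theorem supp_prod (hF : IsPlasmaSolution F M) (T : ℝ) :
    ∃ k : Set (EuclideanSpace ℝ (Fin 2) × EuclideanSpace ℝ (Fin 2)), IsCompact k ∧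
      ∀ t ∈ Ioo 0 T, ∀ z ∉ k, F (t, z) = 0 := by
  obtain ⟨K, hK⟩ := hF.supp T
  refine ⟨Metric.closedBall 0 K ×ˢ Metric.closedBall 0 K,
    (isCompact_closedBall _ _).prod (isCompact_closedBall _ _), fun t ht z hz => ?_⟩
  rw [mem_prod, not_and_or] at hz
  exact hK t ht z.1 z.2 hz

theorem hasCompactSupport (hF : IsPlasmaSolution F M) {t : ℝ} (ht : 0 < t) :
    HasCompactSupport fun z => F (t, z) := by
  obtain ⟨k, hk, h⟩ := hF.supp_prod (t + 1)
  exact HasCompactSupport.intro hk (h t ⟨ht, by linarith⟩)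

theorem density_supp (hF : IsPlasmaSolution F M) (T : ℝ) :
    ∃ k : Set (EuclideanSpace ℝ (Fin 2)), IsCompact k ∧
      ∀ t ∈ Ioo 0 T, ∀ x ∉ k, density F t x = 0 := by
  obtain ⟨K, hK⟩ := hF.supp T
  refine ⟨Metric.closedBall 0 K, isCompact_closedBall _ _, fun t ht x hx => ?_⟩
  simp [density, hK t ht x _ (Or.inl hx)]

theorem contDiffOn_density (hF : IsPlasmaSolution F M) (T : ℝ) :
    ContDiffOn ℝ 1 (fun p : ℝ × EuclideanSpace ℝ (Fin 2) => density F p.1 p.2)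
      (Ioo 0 T ×ˢ univ) := by
  obtain ⟨K, hK⟩ := hF.supp T
  have h := hF.contDiff
  exact contDiffOn_integral_of_contDiff
    (g := fun q : (ℝ × EuclideanSpace ℝ (Fin 2)) × EuclideanSpace ℝ (Fin 2) =>
      F (q.1.1, q.1.2, q.2)) volume (by fun_prop) (isCompact_closedBall 0 K)
    (isOpen_Ioo.prod isOpen_univ) (fun p hp v hv => hK p.1 hp.1 p.2 v (Or.inr hv))

theorem contDiff_density (hF : IsPlasmaSolution F M) {t : ℝ} (ht : 0 < t) :
    ContDiff ℝ 1 (density F t) := by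
  rw [← contDiffOn_univ]
  exact (hF.contDiffOn_density (t + 1)).comp (f := fun x => (t, x)) (by fun_prop)
    (fun x _ => ⟨⟨ht, by linarith⟩, mem_univ _⟩)

theorem hasCompactSupport_density (hF : IsPlasmaSolution F M) {t : ℝ} (ht : 0 < t) :
    HasCompactSupport (density F t) := by
  obtain ⟨k, hk, h⟩ := hF.density_supp (t + 1)
  exact HasCompactSupport.intro hk (h t ⟨ht, by linarith⟩)

theorem density_nonneg (hF : IsPlasmaSolution F M) (t : ℝ) (x : EuclideanSpace ℝ (Fin 2)) :
    0 ≤ density F t x :=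
  integral_nonneg fun _ => hF.nonneg _

theorem contDiff_potential (hF : IsPlasmaSolution F M) {t : ℝ} (ht : 0 < t) :
    ContDiff ℝ 1 (logPotential (density F t)) :=
  contDiff_logPotential (hF.contDiff_density ht) (hF.hasCompactSupport_density ht)

theorem continuous_force (hF : IsPlasmaSolution F M) {t : ℝ} (ht : 0 < t) :
    Continuous (force F t) := by
  have h := (hF.contDiff_potential ht).continuous_fderiv (by norm_num)
  unfold force gradient
  fun_prop

theorem inner_force (t : ℝ) (x w : EuclideanSpace ℝ (Fin 2)) :
    inner ℝ w (force F t x) = 1 / (2 * π) * fderiv ℝ (logPotential (density F t)) x w := by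
  rw [force, inner_smul_right, real_inner_comm, gradient, InnerProductSpace.toDual_symm_apply]

theorem hasDerivAt_integral (hF : IsPlasmaSolution F M)
    {g : ℝ × EuclideanSpace ℝ (Fin 2) × EuclideanSpace ℝ (Fin 2) → ℝ} (hg : ContDiff ℝ 1 g)
    (hgF : ∀ p, F p = 0 → g p = 0) {t : ℝ} (ht : 0 < t) :
    HasDerivAt (fun t => ∫ z, g (t, z)) (∫ z, fderiv ℝ g (t, z) (1, 0)) t := by
  obtain ⟨k, hk, h⟩ := hF.supp_prod (t + 1)
  exact hasDerivAt_integral_of_contDiff volume hg hk isOpen_Ioo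
    (fun s hs z hz => hgF _ (h s hs z hz)) ⟨ht, by linarith⟩

theorem hasDerivAt_integral_transport (hF : IsPlasmaSolution F M)
    {g : ℝ × EuclideanSpace ℝ (Fin 2) × EuclideanSpace ℝ (Fin 2) → ℝ} (hg : ContDiff ℝ 1 g)
    (hgF : ∀ p, F p = 0 → g p = 0) {t : ℝ} (ht : 0 < t) :
    HasDerivAt (fun t => ∫ z, g (t, z))
      (∫ z : EuclideanSpace ℝ (Fin 2) × EuclideanSpace ℝ (Fin 2),
        fderiv ℝ g (t, z) (1, z.2, force F t z.1)) t := by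
  refine (hF.hasDerivAt_integral hg hgF ht).congr_deriv ?_
  obtain ⟨k, hk, h⟩ := hF.supp_prod (t + 1)
  have hsl : ContDiff ℝ 1 fun z => g (t, z) := by fun_prop
  have hcs : HasCompactSupport fun z => g (t, z) :=
    HasCompactSupport.intro hk fun z hz => hgF _ (h t ⟨ht, by linarith⟩ z hz)
  have hb := hF.continuous_force ht
  have h0 := integral_fderiv_transport_eq_zero hsl hcs hb
  have hslice : ∀ z w, fderiv ℝ (fun z => g (t, z)) z w = fderiv ℝ g (t, z) (0, w) := by
    intro z w
    have := (HasFDerivAt.comp (f := fun z => (t, z)) z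
      (hg.differentiable (by norm_num) (t, z)).hasFDerivAt
      ((hasFDerivAt_const t z).prodMk (hasFDerivAt_id z))).fderiv
    simp only [Function.comp_def] at this
    simp [this]
  have hDc : Continuous (fderiv ℝ fun z => g (t, z)) := hsl.continuous_fderiv (by norm_num)
  have i2 : Integrable fun z : EuclideanSpace ℝ (Fin 2) × EuclideanSpace ℝ (Fin 2) =>
      fderiv ℝ (fun z => g (t, z)) z (z.2, force F t z.1) := by
    refine (hDc.clm_apply (by fun_prop)).integrable_of_hasCompactSupport
      ((hcs.fderiv (𝕜 := ℝ)).mono fun z hz h => ?_)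
    simp [h] at hz
  have i1 : Integrable fun z => fderiv ℝ g (t, z) (1, 0) := by
    have hc := hg.continuous_fderiv (by norm_num)
    refine Continuous.integrable_of_hasCompactSupport (by fun_prop)
      (HasCompactSupport.intro hk fun z hz => ?_)
    have hd : HasDerivAt (fun r => g (r, z)) (fderiv ℝ g (t, z) (1, 0)) t :=
      (hg.differentiable (by norm_num) (t, z)).hasFDerivAt.comp_hasDerivAt t
        ((hasDerivAt_id t).prodMk (hasDerivAt_const t z))
    rw [← hd.deriv]
    have : (fun r => g (r, z)) =ᶠ[𝓝 t] fun _ => 0 := by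
      filter_upwards [isOpen_Ioo.mem_nhds (⟨ht, by linarith⟩ : t ∈ Ioo 0 (t + 1))] with r hr
        using hgF _ (h r hr z hz)
    rw [this.deriv_eq]; simp
  rw [← add_zero (∫ z, fderiv ℝ g (t, z) (1, 0)), ← h0, ← integral_add i1 i2]
  refine integral_congr_ae (Eventually.of_forall fun z => ?_)
  simp only [hslice]
  rw [← map_add]
  simp

theorem hasDerivAt_moment (hF : IsPlasmaSolution F M)
    {ψ : EuclideanSpace ℝ (Fin 2) × EuclideanSpace ℝ (Fin 2) → ℝ} (hψ : ContDiff ℝ 1 ψ)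
    {t : ℝ} (ht : 0 < t) :
    HasDerivAt (fun t => ∫ z, ψ z * F (t, z))
      (∫ z : EuclideanSpace ℝ (Fin 2) × EuclideanSpace ℝ (Fin 2),
        fderiv ℝ ψ z (z.2, force F t z.1) * F (t, z)) t := by
  have hFc := hF.contDiff
  have h := hF.hasDerivAt_integral_transport (g := fun p => ψ p.2 * F p) (by fun_prop)
    (fun p hp => by simp [hp]) ht
  refine h.congr_deriv (integral_congr_ae (Eventually.of_forall fun z => ?_))
  have h1 : HasFDerivAt (fun p : ℝ × EuclideanSpace ℝ (Fin 2) × EuclideanSpace ℝ (Fin 2) => ψ p.2)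
      _ (t, z) := HasFDerivAt.comp (g := ψ) (t, z)
        (hψ.differentiable (by norm_num) z).hasFDerivAt hasFDerivAt_snd
  have h2 : fderiv ℝ (fun p => ψ p.2 * F p) (t, z) = _ :=
    (h1.mul (hFc.differentiable (by norm_num) (t, z)).hasFDerivAt).fderiv
  simp only [h2]
  have h3 := hF.vlasov t ht z.1 z.2
  simp only [Prod.mk.eta] at h3
  simp [h3]
  ring

theorem exists_bound (hF : IsPlasmaSolution F M) :
    ∃ A, 0 < A ∧ ∀ t, 1 ≤ t → ∀ z, F (t, z) ≤ A := by
  have hFc := hF.contDiff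
  have hc1 : Continuous fun z => F (1, z) := by fun_prop
  obtain ⟨A, hA⟩ := (hF.hasCompactSupport one_pos).exists_bound_of_continuous hc1
  have hA' : ∀ z, F (1, z) ≤ |A| + 1 := fun z => by
    have := hA z
    rw [Real.norm_of_nonneg (hF.nonneg _)] at this
    linarith [le_abs_self A]
  refine ⟨|A| + 1, by positivity, ?_⟩
  set B := |A| + 1 with hB
  have hBpos : 0 < B := by positivity
  let θ : ℝ → ℝ := fun s => (max (s - B) 0) ^ 2
  have hθd : ∀ s, HasDerivAt θ (2 * max (s - B) 0) s := fun s => by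
    simpa using (hasDerivAt_max_zero_sq (s - B)).comp_sub_const s B
  have hθ : ContDiff ℝ 1 θ := by
    rw [contDiff_one_iff_deriv]
    refine ⟨fun s => (hθd s).differentiableAt, ?_⟩
    have : deriv θ = fun s => 2 * max (s - B) 0 := funext fun s => (hθd s).deriv
    rw [this]
    fun_prop
  have hθ0 : ∀ s, s ≤ B → θ s = 0 := fun s hs => by
    simp [θ, max_eq_right (sub_nonpos.2 hs)]
  have hder : ∀ t, 0 < t → HasDerivAt (fun t => ∫ z, θ (F (t, z))) 0 t := by
    intro t ht
    have h := hF.hasDerivAt_integral_transport (g := fun p => θ (F p)) (by fun_prop)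
      (fun p hp => by rw [hp]; exact hθ0 0 hBpos.le) ht
    refine h.congr_deriv (integral_eq_zero_of_ae (Eventually.of_forall fun z => ?_))
    have h2 : fderiv ℝ (fun p => θ (F p)) (t, z) = _ :=
      ((hθd (F (t, z))).comp_hasFDerivAt (t, z)
        (hFc.differentiable (by norm_num) (t, z)).hasFDerivAt).fderiv
    have h3 := hF.vlasov t ht z.1 z.2
    simp only [Prod.mk.eta] at h3
    simp [h2, h3]
  have hconst : ∀ t, 1 ≤ t → ∫ z, θ (F (t, z)) = 0 := by
    intro t ht
    have h := (convex_Ioi (0 : ℝ)).is_const_of_fderivWithin_eq_zero (𝕜 := ℝ)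
      (f := fun t => ∫ z, θ (F (t, z))) (x := t) (y := 1)
      (fun s hs => (hder s hs).differentiableAt.differentiableWithinAt)
      (fun s hs => by
        rw [fderivWithin_of_isOpen isOpen_Ioi hs, ← toSpanSingleton_deriv, (hder s hs).deriv]
        simp)
      (by simp only [mem_Ioi]; linarith) (by simp)
    rw [h]
    simp [hθ0 _ (hA' _)]
  intro t ht z
  by_contra hz
  push Not at hz
  have ht0 : 0 < t := by linarith
  have hcont : Continuous fun z => θ (F (t, z)) := by
    have := hθ.continuous
    fun_prop
  have hcs : HasCompactSupport fun z => θ (F (t, z)) :=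
    (hF.hasCompactSupport ht0).comp_left (hθ0 0 hBpos.le)
  have hpos := hcont.integral_pos_of_hasCompactSupport_nonneg_nonzero (μ := volume) (x := z) hcs
    (fun z => by positivity) (by
      have : 0 < max (F (t, z) - B) 0 := lt_max_of_lt_left (by linarith)
      positivity)
  rw [hconst t ht] at hpos
  exact lt_irrefl _ hpos

theorem integrable_mul (hF : IsPlasmaSolution F M) {t : ℝ} (ht : 0 < t)
    {ψ : EuclideanSpace ℝ (Fin 2) × EuclideanSpace ℝ (Fin 2) → ℝ} (hψ : Continuous ψ) :
    Integrable fun z => ψ z * F (t, z) := by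
  have := hF.contDiff.continuous
  exact Continuous.integrable_of_hasCompactSupport (by fun_prop)
    (hF.hasCompactSupport ht).mul_left

theorem integral_mul_eq_integral_density (hF : IsPlasmaSolution F M) {t : ℝ} (ht : 0 < t)
    {h : EuclideanSpace ℝ (Fin 2) → ℝ} (hh : Continuous h) :
    ∫ z : EuclideanSpace ℝ (Fin 2) × EuclideanSpace ℝ (Fin 2), h z.1 * F (t, z)
      = ∫ x, h x * density F t x := by
  have hi := hF.integrable_mul ht (ψ := fun z => h z.1) (by fun_prop)
  rw [Measure.volume_eq_prod] at hi ⊢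
  rw [integral_prod _ hi]
  simp only [density, integral_const_mul]

theorem integral_density (hF : IsPlasmaSolution F M) {t : ℝ} (ht : 0 < t) :
    ∫ x, density F t x = M := by
  have h := hF.integral_mul_eq_integral_density ht (h := fun _ => 1) (by fun_prop)
  simp only [one_mul] at h
  rw [← h, hF.mass t ht]

theorem hasDerivAt_inertia (hF : IsPlasmaSolution F M) {t : ℝ} (ht : 0 < t) :
    HasDerivAt (fun t => ∫ z : EuclideanSpace ℝ (Fin 2) × EuclideanSpace ℝ (Fin 2),
        ‖z.1‖ ^ 2 / 2 * F (t, z))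
      (∫ z : EuclideanSpace ℝ (Fin 2) × EuclideanSpace ℝ (Fin 2),
        inner ℝ z.1 z.2 * F (t, z)) t := by
  have h := hF.hasDerivAt_moment (ψ := fun z => ‖z.1‖ ^ 2 / 2)
    ((contDiff_fst.norm_sq ℝ).div_const 2) ht
  refine h.congr_deriv (integral_congr_ae (Eventually.of_forall fun z => ?_))
  have hd : HasFDerivAt (fun z : EuclideanSpace ℝ (Fin 2) × EuclideanSpace ℝ (Fin 2) =>
      ‖z.1‖ ^ 2 * (1 / 2)) _ z := (hasFDerivAt_fst (p := z)).norm_sq.mul_const (1 / 2)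
  simp only [mul_one_div] at hd
  simp only [hd.fderiv]
  simp

theorem hasDerivAt_virial (hF : IsPlasmaSolution F M) {t : ℝ} (ht : 0 < t) :
    HasDerivAt (fun t => ∫ z : EuclideanSpace ℝ (Fin 2) × EuclideanSpace ℝ (Fin 2),
        inner ℝ z.1 z.2 * F (t, z))
      (2 * (∫ z : EuclideanSpace ℝ (Fin 2) × EuclideanSpace ℝ (Fin 2),
        ‖z.2‖ ^ 2 / 2 * F (t, z)) + M ^ 2 / (4 * π)) t := by
  have h := hF.hasDerivAt_moment (ψ := fun z => inner ℝ z.1 z.2)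
    (contDiff_fst.inner ℝ contDiff_snd) ht
  refine h.congr_deriv ?_
  have hfc := hF.continuous_force ht
  have hΦ := (hF.contDiff_potential ht).continuous_fderiv (by norm_num)
  have e : ∀ z : EuclideanSpace ℝ (Fin 2) × EuclideanSpace ℝ (Fin 2),
      fderiv ℝ (fun z : EuclideanSpace ℝ (Fin 2) × EuclideanSpace ℝ (Fin 2) => inner ℝ z.1 z.2) z
        (z.2, force F t z.1) * F (t, z) = 2 * (‖z.2‖ ^ 2 / 2 * F (t, z)) +
        1 / (2 * π) * (fderiv ℝ (logPotential (density F t)) z.1 z.1 * F (t, z)) := by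
    intro z
    rw [fderiv_inner_apply ℝ differentiableAt_fst differentiableAt_snd]
    simp only [fderiv_fst, fderiv_snd, ContinuousLinearMap.coe_fst', ContinuousLinearMap.coe_snd']
    rw [inner_force, real_inner_self_eq_norm_sq]
    ring
  simp_rw [e]
  rw [integral_add, integral_const_mul, integral_const_mul,
    hF.integral_mul_eq_integral_density ht
      (h := fun x => fderiv ℝ (logPotential (density F t)) x x) (by fun_prop),
    integral_fderiv_logPotential_self_mul (hF.contDiff_density ht)
      (hF.hasCompactSupport_density ht), hF.integral_density ht]
  · field_simp
    ring
  · exact (hF.integrable_mul ht (ψ := fun z => ‖z.2‖ ^ 2 / 2) (by fun_prop)).const_mul _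
  · exact (hF.integrable_mul ht
      (ψ := fun z => fderiv ℝ (logPotential (density F t)) z.1 z.1) (by fun_prop)).const_mul _

theorem hasDerivAt_kinetic (hF : IsPlasmaSolution F M) {t : ℝ} (ht : 0 < t) :
    HasDerivAt (fun t => ∫ z : EuclideanSpace ℝ (Fin 2) × EuclideanSpace ℝ (Fin 2),
        ‖z.2‖ ^ 2 / 2 * F (t, z))
      (1 / (2 * π) * ∫ z : EuclideanSpace ℝ (Fin 2) × EuclideanSpace ℝ (Fin 2),
        fderiv ℝ (logPotential (density F t)) z.1 z.2 * F (t, z)) t := by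
  have h := hF.hasDerivAt_moment (ψ := fun z => ‖z.2‖ ^ 2 / 2)
    ((contDiff_snd.norm_sq ℝ).div_const 2) ht
  refine h.congr_deriv ?_
  rw [← integral_const_mul]
  refine integral_congr_ae (Eventually.of_forall fun z => ?_)
  have hd : HasFDerivAt (fun z : EuclideanSpace ℝ (Fin 2) × EuclideanSpace ℝ (Fin 2) =>
      ‖z.2‖ ^ 2 * (1 / 2)) _ z := (hasFDerivAt_snd (p := z)).norm_sq.mul_const (1 / 2)
  simp only [mul_one_div] at hd
  simp only [hd.fderiv]
  have := inner_force (F := F) t z.1 z.2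
  simp [this]
  ring

theorem hasDerivAt_interaction (hF : IsPlasmaSolution F M) {t : ℝ} (ht : 0 < t) :
    HasDerivAt (fun t => logEnergy (density F t))
      (2 * ∫ z : EuclideanSpace ℝ (Fin 2) × EuclideanSpace ℝ (Fin 2),
        fderiv ℝ (logPotential (density F t)) z.1 z.2 * F (t, z)) t := by
  obtain ⟨k, hk, hk0⟩ := hF.density_supp (t + 1)
  have htm : t ∈ Ioo 0 (t + 1) := ⟨ht, by linarith⟩
  have h := hasDerivAt_logEnergy isOpen_Ioo (hF.contDiffOn_density (t + 1)) hk hk0 htm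
  refine h.congr_deriv ?_
  congr 1
  have hFc := hF.contDiff
  set Φ := logPotential (density F t) with hΦdef
  have hΦ : ContDiff ℝ 1 Φ := hF.contDiff_potential ht
  have hm := hF.hasDerivAt_moment (ψ := fun z => Φ z.1) (by fun_prop) ht
  have hg := hF.hasDerivAt_integral (g := fun p => Φ p.2.1 * F p) (by fun_prop)
    (fun p hp => by simp [hp]) ht
  have hu := hg.unique hm
  have e1 : ∀ z : EuclideanSpace ℝ (Fin 2) × EuclideanSpace ℝ (Fin 2),
      fderiv ℝ (fun z : EuclideanSpace ℝ (Fin 2) × EuclideanSpace ℝ (Fin 2) => Φ z.1) z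
        (z.2, force F t z.1) = fderiv ℝ Φ z.1 z.2 := by
    intro z
    have h1 : fderiv ℝ (fun z : EuclideanSpace ℝ (Fin 2) × EuclideanSpace ℝ (Fin 2) => Φ z.1) z = _ :=
      (HasFDerivAt.comp (g := Φ) z (hΦ.differentiable (by norm_num) z.1).hasFDerivAt
        hasFDerivAt_fst).fderiv
    simp [h1]
  have e2 : ∀ z : EuclideanSpace ℝ (Fin 2) × EuclideanSpace ℝ (Fin 2),
      fderiv ℝ (fun p : ℝ × EuclideanSpace ℝ (Fin 2) × EuclideanSpace ℝ (Fin 2) => Φ p.2.1 * F p)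
        (t, z) (1, 0) = Φ z.1 * fderiv ℝ F (t, z) (1, 0) := by
    intro z
    have h1 : HasFDerivAt (fun p : ℝ × EuclideanSpace ℝ (Fin 2) × EuclideanSpace ℝ (Fin 2) =>
        Φ p.2.1) _ (t, z) := HasFDerivAt.comp (g := Φ) (t, z)
          (hΦ.differentiable (by norm_num) z.1).hasFDerivAt
          (HasFDerivAt.comp (t, z) (hasFDerivAt_fst (p := z)) (hasFDerivAt_snd (p := (t, z))))
    have h2 : fderiv ℝ (fun p : ℝ × EuclideanSpace ℝ (Fin 2) × EuclideanSpace ℝ (Fin 2) =>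
        Φ p.2.1 * F p) (t, z) = _ :=
      (h1.mul (hFc.differentiable (by norm_num) (t, z)).hasFDerivAt).fderiv
    simp [h2]
  simp_rw [e1, e2] at hu
  rw [← hu]
  obtain ⟨K, hK⟩ := hF.supp (t + 1)
  have e3 : ∀ x, fderiv ℝ (fun p : ℝ × EuclideanSpace ℝ (Fin 2) => density F p.1 p.2) (t, x) (1, 0)
      = ∫ v, fderiv ℝ F (t, x, v) (1, 0) := by
    intro x
    have h1 := hasDerivAt_integral_of_contDiff volume
      (g := fun q : ℝ × EuclideanSpace ℝ (Fin 2) => F (q.1, x, q.2)) (by fun_prop)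
      (isCompact_closedBall 0 K) isOpen_Ioo (fun s hs v hv => hK s hs x v (Or.inr hv)) htm
    have hd : DifferentiableAt ℝ (fun p : ℝ × EuclideanSpace ℝ (Fin 2) => density F p.1 p.2)
        (t, x) := ((hF.contDiffOn_density (t + 1)).differentiableOn (by norm_num)).differentiableAt
          ((isOpen_Ioo.prod isOpen_univ).mem_nhds ⟨htm, mem_univ _⟩)
    have h2 := hd.hasFDerivAt.comp_hasDerivAt t ((hasDerivAt_id t).prodMk (hasDerivAt_const t x))
    rw [h2.unique h1]
    refine integral_congr_ae (Eventually.of_forall fun v => ?_)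
    have h3 : fderiv ℝ (fun q : ℝ × EuclideanSpace ℝ (Fin 2) => F (q.1, x, q.2)) (t, v) = _ :=
      (HasFDerivAt.comp (f := fun q : ℝ × EuclideanSpace ℝ (Fin 2) => (q.1, x, q.2)) (t, v)
        (hFc.differentiable (by norm_num) (t, x, v)).hasFDerivAt
        ((hasFDerivAt_fst (p := (t, v))).prodMk
          ((hasFDerivAt_const x (t, v)).prodMk (hasFDerivAt_snd (p := (t, v)))))).fderiv
    simp [h3]
    rfl
  simp_rw [e3, ← integral_const_mul]
  obtain ⟨k', hk', hk0'⟩ := hF.supp_prod (t + 1)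
  have hi : Integrable (fun z : EuclideanSpace ℝ (Fin 2) × EuclideanSpace ℝ (Fin 2) =>
      Φ z.1 * fderiv ℝ F (t, z) (1, 0)) := by
    have hc := hFc.continuous_fderiv (by norm_num)
    have hΦc := hΦ.continuous
    refine Continuous.integrable_of_hasCompactSupport (by fun_prop)
      (HasCompactSupport.intro hk' fun z hz => ?_)
    have hd : HasDerivAt (fun r => F (r, z)) (fderiv ℝ F (t, z) (1, 0)) t :=
      (hFc.differentiable (by norm_num) (t, z)).hasFDerivAt.comp_hasDerivAt t
        ((hasDerivAt_id t).prodMk (hasDerivAt_const t z))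
    rw [← hd.deriv]
    have : (fun r => F (r, z)) =ᶠ[𝓝 t] fun _ => 0 := by
      filter_upwards [isOpen_Ioo.mem_nhds htm] with r hr using hk0' r hr z hz
    rw [this.deriv_eq]; simp
  rw [Measure.volume_eq_prod] at hi ⊢
  rw [integral_prod _ hi]

end IsPlasmaSolution

/-- An increasing change of time `u ↦ 1 + ∫ s in 0..u, exp (s ^ 2)`. -/
def gaussTime (u : ℝ) : ℝ := 1 + ∫ s in (0 : ℝ)..u, Real.exp (s ^ 2)

theorem hasDerivAt_gaussTime (u : ℝ) : HasDerivAt gaussTime (Real.exp (u ^ 2)) u := by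
  have hc : Continuous fun s : ℝ => Real.exp (s ^ 2) := by fun_prop
  exact (hc.integral_hasStrictDerivAt 0 u).hasDerivAt.const_add 1

theorem one_add_le_gaussTime {u : ℝ} (hu : 0 ≤ u) : 1 + u ≤ gaussTime u := by
  have hc : Continuous fun s : ℝ => Real.exp (s ^ 2) := by fun_prop
  have h := intervalIntegral.integral_mono_on (μ := volume) hu
    (continuous_const (y := (1 : ℝ)).intervalIntegrable 0 u) (hc.intervalIntegrable 0 u)
    fun s _ => Real.one_le_exp (sq_nonneg s)
  simp at h
  rw [gaussTime]
  linarith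

theorem exists_quadratic_lt {I J K P D : ℝ → ℝ} {m C : ℝ}
    (hI : ∀ t, 0 < t → HasDerivAt I (J t) t)
    (hJ : ∀ t, 0 < t → HasDerivAt J (2 * K t + m) t)
    (hK : ∀ t, 0 < t → HasDerivAt K (D t) t)
    (hP : ∀ t, 0 < t → HasDerivAt P (-D t) t)
    (hq : ∀ t, 0 < t → ∀ h, 0 ≤ 2 * K t - 2 * h * J t + 2 * h ^ 2 * I t)
    (hC : ∀ t, 0 < t → ∀ u,
      -C ≤ 2 * P t + 2 * m * u ^ 2 + 4 * I t * Real.exp (-u ^ 2) ^ 2)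
    {δ : ℝ} (hδ : 0 < δ) (T : ℝ) :
    ∃ t, T ≤ t ∧ ∃ h, 2 * K t - 2 * h * J t + 2 * h ^ 2 * I t < δ := by
  by_contra! hcon
  let E : ℝ → ℝ := fun u => Real.exp (-u ^ 2)
  let H : ℝ → ℝ := fun u => 2 * u * E u
  let q : ℝ → ℝ := fun u => 2 * K (gaussTime u) - 2 * H u * J (gaussTime u)
    + 2 * H u ^ 2 * I (gaussTime u)
  let G : ℝ → ℝ := fun u => q u + (2 * P (gaussTime u) + 2 * m * u ^ 2
    + 4 * I (gaussTime u) * E u ^ 2)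
  have hpos : ∀ u, 0 ≤ u → 0 < gaussTime u := fun u hu => by
    linarith [one_add_le_gaussTime hu]
  have hE : ∀ u, HasDerivAt E (-(2 * u) * E u) u := fun u => by
    refine (((hasDerivAt_pow 2 u).neg).exp).congr_deriv ?_
    simp [E]; ring
  have hH : ∀ u, HasDerivAt H (2 * E u - 4 * u ^ 2 * E u) u := fun u => by
    refine (((hasDerivAt_id u).const_mul 2).mul (hE u)).congr_deriv ?_
    simp; ring
  have hG : ∀ u, 0 ≤ u → HasDerivAt G (-4 * u * q u) u := fun u hu => by
    have hτ := hasDerivAt_gaussTime u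
    have h0 := hpos u hu
    have dI := (hI _ h0).comp u hτ
    have dJ := (hJ _ h0).comp u hτ
    have dK := (hK _ h0).comp u hτ
    have dP := (hP _ h0).comp u hτ
    have dq := ((dK.const_mul 2).sub (((hH u).const_mul 2).mul dJ)).add
      ((((hH u).pow 2).const_mul 2).mul dI)
    have dr := ((dP.const_mul 2).add ((hasDerivAt_pow 2 u).const_mul (2 * m))).add
      ((dI.const_mul 4).mul ((hE u).pow 2))
    refine (dq.add dr).congr_deriv ?_
    have hEE : E u * Real.exp (u ^ 2) = 1 := by
      simp only [E]; rw [← Real.exp_add]; simp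
    simp only [q, Pi.pow_apply, H, Function.comp, Nat.cast_ofNat, Nat.add_one_sub_one, pow_one]
    generalize Real.exp (u ^ 2) = e at *
    generalize E u = x at *
    have hxe : x ^ 2 * e = x := by rw [sq, mul_assoc, hEE, mul_one]
    generalize K (gaussTime u) = k
    generalize J (gaussTime u) = j
    generalize I (gaussTime u) = i
    generalize D (gaussTime u) = d
    linear_combination (-8 * u * k - 4 * u * m) * hEE + (8 * u ^ 2 * j + 4 * j) * hxe
  have hq0 : ∀ u, 0 ≤ u → 0 ≤ q u := fun u hu => hq _ (hpos u hu) _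
  set a := max T 0 with ha
  have ha0 : 0 ≤ a := le_max_right _ _
  have hqδ : ∀ u, a ≤ u → δ ≤ q u := fun u hu =>
    hcon _ (by linarith [one_add_le_gaussTime (ha0.trans hu), le_max_left T 0]) _
  let L : ℝ → ℝ := fun u => G u + 2 * δ * u ^ 2
  have hL : ∀ u, 0 ≤ u → HasDerivAt L (-4 * u * (q u - δ)) u := fun u hu => by
    refine ((hG u hu).add ((hasDerivAt_pow 2 u).const_mul (2 * δ))).congr_deriv ?_
    simp; ring
  have hanti : AntitoneOn L (Ici a) := by
    refine antitoneOn_of_deriv_nonpos (convex_Ici a)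
      (fun u hu => (hL u (ha0.trans hu)).continuousAt.continuousWithinAt)
      (fun u hu => ?_) fun u hu => ?_
    · rw [interior_Ici] at hu
      exact (hL u (ha0.trans (le_of_lt hu))).differentiableAt.differentiableWithinAt
    · rw [interior_Ici] at hu
      have hu0 := ha0.trans (le_of_lt hu)
      rw [(hL u hu0).deriv]
      have := mul_nonneg hu0 (sub_nonneg.2 (hqδ u (le_of_lt hu)))
      linarith
  have key : ∀ u, a ≤ u → 2 * δ * u ^ 2 ≤ L a + C := fun u hu => by
    have h1 := hanti (self_mem_Ici) (mem_Ici.2 hu) hu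
    have h2 := hC _ (hpos u (ha0.trans hu)) u
    have h3 := hq0 u (ha0.trans hu)
    simp only [L, G, E] at h1 h2 ⊢
    linarith
  have htop : Tendsto (fun u : ℝ => 2 * δ * u ^ 2) atTop atTop :=
    (tendsto_pow_atTop (by norm_num)).const_mul_atTop (by positivity)
  obtain ⟨u, hu1, hu2⟩ := ((htop.eventually_gt_atTop (L a + C)).and
    (eventually_ge_atTop a)).exists
  linarith [key u hu2]

theorem log_norm_le {M : ℝ} (hM : 0 < M) (r u : ℝ) :
    Real.log r ≤ u ^ 2 + |Real.log M| / 2 + Real.exp (-u ^ 2) ^ 2 / (2 * M) * r ^ 2 := by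
  have hE := Real.exp_pos (-u ^ 2)
  rcases eq_or_ne r 0 with rfl | hr
  · rw [Real.log_zero]; positivity
  · have hy : 0 < (r * Real.exp (-u ^ 2)) ^ 2 / M := by positivity
    have h := Real.log_le_sub_one_of_pos hy
    rw [Real.log_div (by positivity) hM.ne', Real.log_pow, Real.log_mul hr hE.ne',
      Real.log_exp] at h
    have e : (r * Real.exp (-u ^ 2)) ^ 2 / M =
        2 * (Real.exp (-u ^ 2) ^ 2 / (2 * M) * r ^ 2) := by field_simp
    rw [e] at h
    push_cast at h
    linarith [le_abs_self (Real.log M)]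

theorem sq_le_of_forall_mul_le {ρ a k : ℝ} (ha : 0 < a) (hρ : 0 ≤ ρ)
    (h : ∀ y, 0 ≤ y → y * ρ ≤ a * y ^ 2 + k) : ρ ^ 2 ≤ 4 * a * k := by
  have h1 := h (ρ / (2 * a)) (by positivity)
  have e1 : ρ / (2 * a) * ρ = ρ ^ 2 / (2 * a) := by ring
  have e2 : a * (ρ / (2 * a)) ^ 2 = ρ ^ 2 / (4 * a) := by field_simp; norm_num
  have e3 : ρ ^ 2 / (2 * a) = 2 * (ρ ^ 2 / (4 * a)) := by field_simp; norm_num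
  rw [e1, e2, e3] at h1
  have h2 : ρ ^ 2 / (4 * a) ≤ k := by linarith
  rw [div_le_iff₀ (by positivity)] at h2
  linarith

namespace IsPlasmaSolution

variable {F : ℝ × EuclideanSpace ℝ (Fin 2) × EuclideanSpace ℝ (Fin 2) → ℝ} {M : ℝ}

theorem integral_sq_norm_sub (hF : IsPlasmaSolution F M) {t : ℝ} (ht : 0 < t) (h : ℝ) :
    ∫ z : EuclideanSpace ℝ (Fin 2) × EuclideanSpace ℝ (Fin 2), ‖z.2 - h • z.1‖ ^ 2 * F (t, z)
      = 2 * (∫ z : EuclideanSpace ℝ (Fin 2) × EuclideanSpace ℝ (Fin 2), ‖z.2‖ ^ 2 / 2 * F (t, z))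
        - 2 * h * (∫ z : EuclideanSpace ℝ (Fin 2) × EuclideanSpace ℝ (Fin 2),
          inner ℝ z.1 z.2 * F (t, z))
        + 2 * h ^ 2 * ∫ z : EuclideanSpace ℝ (Fin 2) × EuclideanSpace ℝ (Fin 2),
          ‖z.1‖ ^ 2 / 2 * F (t, z) := by
  have hK := (hF.integrable_mul ht (ψ := fun z => ‖z.2‖ ^ 2 / 2) (by fun_prop)).const_mul 2
  have hJ := (hF.integrable_mul ht (ψ := fun z => inner ℝ z.1 z.2) (by fun_prop)).const_mul (2 * h)
  have hI := (hF.integrable_mul ht (ψ := fun z => ‖z.1‖ ^ 2 / 2) (by fun_prop)).const_mul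
    (2 * h ^ 2)
  have hadd := integral_add (hK.sub hJ) hI
  simp only [Pi.sub_apply] at hadd
  rw [← integral_const_mul, ← integral_const_mul, ← integral_const_mul, ← integral_sub hK hJ,
    ← hadd]
  refine integral_congr_ae (Eventually.of_forall fun z => ?_)
  simp only
  rw [norm_sub_sq_real, inner_smul_right, norm_smul, mul_pow, Real.norm_eq_abs, sq_abs,
    real_inner_comm]
  ring

theorem logEnergy_le (hF : IsPlasmaSolution F M) (hM : 0 < M) {t : ℝ} (ht : 0 < t) (u : ℝ) :
    logEnergy (density F t) ≤ (u ^ 2 + |Real.log M| / 2) * M ^ 2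
      + 4 * Real.exp (-u ^ 2) ^ 2 * ∫ z : EuclideanSpace ℝ (Fin 2) × EuclideanSpace ℝ (Fin 2),
          ‖z.1‖ ^ 2 / 2 * F (t, z) := by
  obtain ⟨k, hk, hk0⟩ := hF.density_supp (t + 1)
  have hσk : ∀ x ∉ k, density F t x = 0 := fun x hx => hk0 t ⟨ht, by linarith⟩ x hx
  have hσ := (hF.contDiff_density ht).continuous
  have hcs := hF.hasCompactSupport_density ht
  set σ := density F t with hσdef
  set c := u ^ 2 + |Real.log M| / 2 with hc
  set E := Real.exp (-u ^ 2) with hE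
  have hi0 : Integrable σ := hσ.integrable_of_hasCompactSupport hcs
  have hi2 : Integrable fun x => ‖x‖ ^ 2 * σ x :=
    Continuous.integrable_of_hasCompactSupport (by fun_prop) hcs.mul_left
  have e00 := integral_prod_mul (μ := volume) (ν := volume) σ σ
  have e20 := integral_prod_mul (μ := volume) (ν := volume) (fun x => ‖x‖ ^ 2 * σ x) σ
  have e02 := integral_prod_mul (μ := volume) (ν := volume) σ (fun x => ‖x‖ ^ 2 * σ x)
  have i00 := (hi0.mul_prod hi0).const_mul c
  have i20 := (hi2.mul_prod hi0).const_mul (E ^ 2 / M)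
  have i02 := (hi0.mul_prod hi2).const_mul (E ^ 2 / M)
  have hX : ∫ x, ‖x‖ ^ 2 * σ x =
      2 * ∫ z : EuclideanSpace ℝ (Fin 2) × EuclideanSpace ℝ (Fin 2), ‖z.1‖ ^ 2 / 2 * F (t, z) := by
    rw [hF.integral_mul_eq_integral_density ht (h := fun x => ‖x‖ ^ 2 / 2) (by fun_prop),
      ← integral_const_mul]
    refine integral_congr_ae (Eventually.of_forall fun x => ?_)
    simp only [hσdef]; ring
  have hle : logEnergy σ ≤ ∫ p : EuclideanSpace ℝ (Fin 2) × EuclideanSpace ℝ (Fin 2),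
      (c * (σ p.1 * σ p.2) + E ^ 2 / M * (‖p.1‖ ^ 2 * σ p.1 * σ p.2)
        + E ^ 2 / M * (σ p.1 * (‖p.2‖ ^ 2 * σ p.2))) ∂(volume.prod volume) := by
    rw [logEnergy]
    refine integral_mono (integrable_log_norm_sub_mul hk hσ hσ hσk hσk)
      ((i00.add i20).add i02) fun p => ?_
    have h1 := log_norm_le hM ‖p.1 - p.2‖ u
    have h2 : ‖p.1 - p.2‖ ^ 2 ≤ 2 * ‖p.1‖ ^ 2 + 2 * ‖p.2‖ ^ 2 := by
      have := parallelogram_law_with_norm ℝ p.1 p.2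
      nlinarith [sq_nonneg ‖p.1 + p.2‖]
    have h3 : 0 ≤ σ p.1 * σ p.2 := mul_nonneg (hF.density_nonneg t _) (hF.density_nonneg t _)
    have h4 : Real.log ‖p.1 - p.2‖ ≤ c + E ^ 2 / M * (‖p.1‖ ^ 2 + ‖p.2‖ ^ 2) := by
      refine h1.trans ?_
      have h5 := mul_le_mul_of_nonneg_left h2 (by positivity : 0 ≤ E ^ 2 / (2 * M))
      have h6 : E ^ 2 / (2 * M) * (2 * ‖p.1‖ ^ 2 + 2 * ‖p.2‖ ^ 2)
        = E ^ 2 / M * (‖p.1‖ ^ 2 + ‖p.2‖ ^ 2) := by field_simp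
      linarith
    refine (mul_le_mul_of_nonneg_right h4 h3).trans (le_of_eq ?_)
    ring
  refine hle.trans (le_of_eq ?_)
  have hadd := integral_add (i00.add i20) i02
  simp only [Pi.add_apply] at hadd
  rw [hadd, integral_add i00 i20, integral_const_mul, integral_const_mul,
    integral_const_mul, e00, e20, e02, hX, hσdef, hF.integral_density ht]
  field_simp
  ring

theorem exists_dispersion_lt (hF : IsPlasmaSolution F M) (hM : 0 < M) {δ : ℝ} (hδ : 0 < δ)
    (T : ℝ) : ∃ t, T ≤ t ∧ 1 ≤ t ∧ ∃ h : ℝ,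
      ∫ z : EuclideanSpace ℝ (Fin 2) × EuclideanSpace ℝ (Fin 2),
        ‖z.2 - h • z.1‖ ^ 2 * F (t, z) < δ := by
  obtain ⟨t, htT, h, hlt⟩ := exists_quadratic_lt (fun t ht => hF.hasDerivAt_inertia ht)
    (fun t ht => hF.hasDerivAt_virial ht) (fun t ht => hF.hasDerivAt_kinetic ht)
    (P := fun t => -(1 / (4 * π)) * logEnergy (density F t))
    (C := |Real.log M| * M ^ 2 / (4 * π))
    (fun t ht => ((hF.hasDerivAt_interaction ht).const_mul _).congr_deriv (by field_simp; norm_num))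
    (fun t ht h => by
      rw [← hF.integral_sq_norm_sub ht h]
      exact integral_nonneg fun z => mul_nonneg (sq_nonneg _) (hF.nonneg _))
    (fun t ht u => by
      have h1 := hF.logEnergy_le hM ht u
      have hI : 0 ≤ ∫ z : EuclideanSpace ℝ (Fin 2) × EuclideanSpace ℝ (Fin 2),
          ‖z.1‖ ^ 2 / 2 * F (t, z) :=
        integral_nonneg fun z => mul_nonneg (by positivity) (hF.nonneg _)
      have h2 := mul_le_mul_of_nonneg_left h1 (by positivity : 0 ≤ 1 / (2 * π))
      have h3 : 0 ≤ (1 - 1 / (2 * π)) *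
          (4 * (∫ z : EuclideanSpace ℝ (Fin 2) × EuclideanSpace ℝ (Fin 2),
            ‖z.1‖ ^ 2 / 2 * F (t, z)) * Real.exp (-u ^ 2) ^ 2) := by
        refine mul_nonneg ?_ (by positivity)
        rw [sub_nonneg, div_le_one (by positivity)]
        linarith [Real.pi_gt_three]
      have e1 : 2 * (-(1 / (4 * π)) * logEnergy (density F t))
          = -(1 / (2 * π) * logEnergy (density F t)) := by field_simp; norm_num
      have e2 : 2 * (M ^ 2 / (4 * π)) * u ^ 2 = 1 / (2 * π) * (M ^ 2 * u ^ 2) := by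
        field_simp; norm_num
      have e3 : |Real.log M| * M ^ 2 / (4 * π) = 1 / (2 * π) * (|Real.log M| / 2 * M ^ 2) := by
        field_simp; norm_num
      rw [e1, e2, e3]
      linarith) hδ (max T 1)
  refine ⟨t, (le_max_left _ _).trans htT, (le_max_right _ _).trans htT, h, ?_⟩
  rwa [hF.integral_sq_norm_sub (by linarith [(le_max_right T 1).trans htT])]

theorem exists_integral_density_sq_le (hF : IsPlasmaSolution F M) :
    ∃ A, 0 < A ∧ ∀ t, 1 ≤ t → ∀ h : ℝ, ∫ x, density F t x ^ 2 ≤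
      A * ∫ z : EuclideanSpace ℝ (Fin 2) × EuclideanSpace ℝ (Fin 2),
        ‖z.2 - h • z.1‖ ^ 2 * F (t, z) := by
  obtain ⟨A, hA, hFA⟩ := hF.exists_bound
  have hFc := hF.contDiff.continuous
  refine ⟨4 * (A * π), by positivity, fun t ht1 h => ?_⟩
  have ht : 0 < t := by linarith
  obtain ⟨K, hK⟩ := hF.supp (t + 1)
  have htm : t ∈ Ioo 0 (t + 1) := ⟨ht, by linarith⟩
  have hi := hF.integrable_mul ht (ψ := fun z => ‖z.2 - h • z.1‖ ^ 2) (by fun_prop)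
  rw [Measure.volume_eq_prod] at hi ⊢
  rw [integral_prod _ hi, ← integral_const_mul]
  have hσ := (hF.contDiff_density ht).continuous
  refine integral_mono (Continuous.integrable_of_hasCompactSupport (by fun_prop) ?_)
    (hi.integral_prod_left.const_mul _) fun x => ?_
  · simp only [sq]
    exact (hF.hasCompactSupport_density ht).mul_left
  · refine sq_le_of_forall_mul_le (by positivity) (hF.density_nonneg t x) fun y hy => ?_
    have hsupp : HasCompactSupport fun v => F (t, x, v) :=
      HasCompactSupport.intro (isCompact_closedBall 0 K) fun v hv => hK t htm x v (Or.inr hv)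
    have iF : Integrable fun v => F (t, x, v) :=
      Continuous.integrable_of_hasCompactSupport (by fun_prop) hsupp
    have iG : Integrable fun v => ‖v - h • x‖ ^ 2 * F (t, x, v) :=
      Continuous.integrable_of_hasCompactSupport (by fun_prop) hsupp.mul_left
    have iB : Integrable ((Metric.ball (h • x) (√y)).indicator fun _ => y * A) :=
      (integrable_indicator_iff Metric.isOpen_ball.measurableSet).2
        (integrableOn_const Metric.isBounded_ball.measure_lt_top.ne)
    have hB : ∫ v, (Metric.ball (h • x) (√y)).indicator (fun _ => y * A) v = A * π * y ^ 2 := by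
      rw [integral_indicator_const _ Metric.isOpen_ball.measurableSet, measureReal_def,
        EuclideanSpace.volume_ball_fin_two, ENNReal.toReal_mul, ENNReal.toReal_pow,
        ENNReal.toReal_ofReal (Real.sqrt_nonneg y), Real.sq_sqrt hy,
        ENNReal.toReal_ofReal Real.pi_pos.le, smul_eq_mul]
      ring
    rw [density, ← integral_const_mul, ← hB, ← integral_add iB iG]
    refine integral_mono (iF.const_mul y) (iB.add iG) fun v => ?_
    simp only [indicator, Metric.mem_ball, dist_eq_norm]
    split_ifs with hv
    · have := mul_le_mul_of_nonneg_left (hFA t ht1 (x, v)) hy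
      have := mul_nonneg (sq_nonneg ‖v - h • x‖) (hF.nonneg (t, x, v))
      linarith
    · rw [not_lt, Real.sqrt_le_left (norm_nonneg _)] at hv
      have := mul_le_mul_of_nonneg_right hv (hF.nonneg (t, x, v))
      linarith

theorem liminf_eLpNorm_density (hF : IsPlasmaSolution F M) (hM : 0 < M) :
    liminf (fun t => eLpNorm (density F t) 2 volume) atTop = 0 := by
  obtain ⟨A, hA, hFA⟩ := hF.exists_integral_density_sq_le
  refine le_antisymm (ENNReal.le_of_forall_pos_le_add fun ε hε _ => ?_) bot_le
  rw [zero_add]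
  refine liminf_le_of_frequently_le' (frequently_atTop.2 fun T => ?_)
  have hε' : (0 : ℝ) < ε := hε
  obtain ⟨t, htT, ht1, h, hlt⟩ := hF.exists_dispersion_lt hM
    (by positivity : (0 : ℝ) < (ε : ℝ) ^ 2 / A) T
  refine ⟨t, htT, ?_⟩
  have ht : 0 < t := by linarith
  have hm : MemLp (density F t) 2 :=
    (hF.contDiff_density ht).continuous.memLp_of_hasCompactSupport (hF.hasCompactSupport_density ht)
  rw [hm.eLpNorm_eq_integral_rpow_norm (by norm_num) (by norm_num),
    ← ENNReal.ofReal_coe_nnreal]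
  refine ENNReal.ofReal_le_ofReal ?_
  have h1 := (hFA t ht1 h).trans (mul_le_mul_of_nonneg_left hlt.le hA.le)
  rw [mul_div_cancel₀ _ hA.ne'] at h1
  have e : ∫ a, ‖density F t a‖ ^ (2 : ℝ≥0∞).toReal = ∫ x, density F t x ^ 2 := by
    refine integral_congr_ae (Eventually.of_forall fun x => ?_)
    simp
  rw [e, ENNReal.toReal_ofNat, ← one_div, ← Real.sqrt_eq_rpow]
  exact Real.sqrt_le_iff.2 ⟨hε'.le, h1⟩

end IsPlasmaSolution

/-- for the 2-dimensional Vlasov–Poisson system in the plasma case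
`ε = −1`, `liminf_{t→∞} ‖ρ(t,·)‖_{L²(ℝ²)} = 0`. -/
theorem stmt5
    (f : ℝ → EuclideanSpace ℝ (Fin 2) → EuclideanSpace ℝ (Fin 2) → ℝ)
    (ρ U : ℝ → EuclideanSpace ℝ (Fin 2) → ℝ) (M : ℝ) (hM : 0 < M)
    -- spatial density and logarithmic potential
    (hρ : ∀ t x, ρ t x = ∫ v, f t x v)
    (hU : ∀ t x, U t x = -(1 / (2 * π)) * ∫ y, Real.log ‖x - y‖ * ρ t y)
    -- `f` is a nonnegative C¹ solution, compactly supported in `(x,v)` locally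
    -- uniformly in `t`, with total mass `M`
    (hf_C1 : ContDiff ℝ 1 (fun p : ℝ × EuclideanSpace ℝ (Fin 2) × EuclideanSpace ℝ (Fin 2) =>
      f p.1 p.2.1 p.2.2))
    (hf_nonneg : ∀ t x v, 0 ≤ f t x v)
    (hf_supp : ∀ T₀ : ℝ, ∃ K₀ : ℝ, ∀ t ∈ Icc (0 : ℝ) T₀, ∀ x v,
      (K₀ ≤ ‖x‖ ∨ K₀ ≤ ‖v‖) → f t x v = 0)
    (hf_mass : ∀ t : ℝ, 0 ≤ t →
      (∫ p : EuclideanSpace ℝ (Fin 2) × EuclideanSpace ℝ (Fin 2), f t p.1 p.2) = M)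
    -- the Vlasov equation `∂_t f + v·∇_x f − ∇_x U·∇_v f = 0`
    (hVlasov : ∀ t : ℝ, 0 ≤ t → ∀ x v,
      deriv (fun s => f s x v) t
        + fderiv ℝ (fun y => f t y v) x v
        - fderiv ℝ (fun w => f t x w) v (gradient (fun y => U t y) x) = 0) :
    Filter.liminf (fun t : ℝ => eLpNorm (fun x => ρ t x) 2 volume) Filter.atTop = 0 := by
  let F : ℝ × EuclideanSpace ℝ (Fin 2) × EuclideanSpace ℝ (Fin 2) → ℝ := fun p => f p.1 p.2.1 p.2.2
  have hden : ∀ t, density F t = ρ t := fun t => funext fun x => (hρ t x).symm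
  have hgrad : ∀ t x, gradient (fun y => U t y) x = -force F t x := by
    intro t x
    have e : (fun y => U t y) = -(1 / (2 * π)) • logPotential (density F t) := by
      funext y
      rw [hU, hden]
      rfl
    rw [e, force, gradient, gradient, fderiv_const_smul_field, Pi.smul_apply, map_smul, neg_smul]
  have hF : IsPlasmaSolution F M := by
    refine ⟨hf_C1, fun p => hf_nonneg _ _ _, fun T => ?_, fun t ht => hf_mass t ht.le,
      fun t ht x v => ?_⟩
    · obtain ⟨K, hK⟩ := hf_supp T
      refine ⟨K, fun t ht x v h => hK t (Ioo_subset_Icc_self ht) x v ?_⟩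
      simp only [mem_closedBall_zero_iff, not_le] at h
      exact h.imp le_of_lt le_of_lt
    · have hd : HasFDerivAt F (fderiv ℝ F (t, x, v)) (t, x, v) :=
        (hf_C1.differentiable (by norm_num) (t, x, v)).hasFDerivAt
      have h1 : deriv (fun s => f s x v) t = fderiv ℝ F (t, x, v) (1, 0) :=
        (HasFDerivAt.comp_hasDerivAt (f := fun s => (s, x, v)) t hd ((hasDerivAt_id t).prodMk (hasDerivAt_const t (x, v)))).deriv
      have h2 : fderiv ℝ (fun y => f t y v) x = _ :=
        (HasFDerivAt.comp (f := fun y => (t, y, v)) x hd ((hasFDerivAt_const t x).prodMk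
          ((hasFDerivAt_id x).prodMk (hasFDerivAt_const v x)))).fderiv
      have h3 : fderiv ℝ (fun w => f t x w) v = _ :=
        (HasFDerivAt.comp (f := fun w => (t, x, w)) v hd ((hasFDerivAt_const t v).prodMk
          ((hasFDerivAt_const x v).prodMk (hasFDerivAt_id v)))).fderiv
      have h := hVlasov t ht.le x v
      rw [h1, h2, h3, hgrad] at h
      simp only [ContinuousLinearMap.comp_apply, ContinuousLinearMap.prod_apply,
        zero_apply, ContinuousLinearMap.id_apply, ← map_add, ← map_sub] at h
      simpa using h
  have h := hF.liminf_eLpNorm_density hM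
  simp only [hden] at h
  exact h
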